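/- Let 0 < k < n and let P be a function from the k-element subsets of [n] to ℝ. The following are equivalent: (i) P is a positive tropical Plücker vector; (ii) for every λ ∈ ℝⁿ, the set Face_P(λ) of k-subsets I maximizing Σ_{i∈I} λ_i − P(I) is the basis family of a positroid on [n]. (Every face of the regular subdivision D_P of the hypersimplex is positroidal if and only if P is a positive tropical Plücker vector.) -/

import Mathlib

/-- The maximal minor `p_I(A)` of a `k × n` matrix `A` on the columns indexed by the
`k`-element subset `I`, taken in increasing order (junk value `0` if `I.card ≠ k`). -/
noncomputable def pMinor {R : Type*} [CommRing R] {k n : ℕ}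
    (A : Matrix (Fin k) (Fin n) R) (I : Finset (Fin n)) : R :=
  if hI : I.card = k then
    Matrix.det (Matrix.of fun r c => A r ((I.orderIsoOfFin hI c : Fin n)))
  else 0

/-- `P` is a positive tropical Plücker vector. -/
def IsPosTropPlucker (n k : ℕ) (P : Finset (Fin n) → ℝ) : Prop :=
  ∀ S : Finset (Fin n), S.card + 2 = k →
    ∀ a b c d : Fin n, a < b → b < c → c < d →
      a ∉ S → b ∉ S → c ∉ S → d ∉ S →
      ((P (S ∪ {a, c}) + P (S ∪ {b, d}) = P (S ∪ {a, b}) + P (S ∪ {c, d}) ∧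
        P (S ∪ {a, b}) + P (S ∪ {c, d}) ≤ P (S ∪ {a, d}) + P (S ∪ {b, c})) ∨
       (P (S ∪ {a, c}) + P (S ∪ {b, d}) = P (S ∪ {a, d}) + P (S ∪ {b, c}) ∧
        P (S ∪ {a, d}) + P (S ∪ {b, c}) ≤ P (S ∪ {a, b}) + P (S ∪ {c, d})))

/-- `ℬ` is the basis family of a positroid on `[n]`: the family of `k`-subsets with
nonzero maximal minor, for some real `k × n` matrix with all maximal minors `≥ 0`. -/
def IsPositroidFamily (n k : ℕ) (ℬ : Set (Finset (Fin n))) : Prop :=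
  ∃ A : Matrix (Fin k) (Fin n) ℝ,
    (∀ I : Finset (Fin n), I.card = k → 0 ≤ pMinor A I) ∧
    (∀ I : Finset (Fin n), I ∈ ℬ ↔ I.card = k ∧ pMinor A I ≠ 0)

/-- The vertex set of the face of the regular subdivision `D_P` of the hypersimplex
selected by `λ`: the `k`-subsets `I` maximizing `∑_{i ∈ I} λ_i - P(I)`. -/
def FaceOf (n k : ℕ) (P : Finset (Fin n) → ℝ) (lam : Fin n → ℝ) : Set (Finset (Fin n)) :=
  {I | I.card = k ∧ ∀ J : Finset (Fin n), J.card = k →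
    (∑ i ∈ J, lam i) - P J ≤ (∑ i ∈ I, lam i) - P I}

section

open Matrix Finset Filter Topology

section PluckerRelations

variable {R : Type*} [CommRing R]

theorem det_vecCons_threeTerm {m : ℕ} (s : Fin m → Fin (m + 2) → R) (a b c d : Fin (m + 2) → R) :
    det (of (vecCons a (vecCons b s))) * det (of (vecCons c (vecCons d s))) =
      det (of (vecCons c (vecCons b s))) * det (of (vecCons a (vecCons d s))) +
      det (of (vecCons a (vecCons c s))) * det (of (vecCons b (vecCons d s))) := by
  set M : Matrix (Fin (m + 2)) (Fin (m + 2)) R := of (vecCons a (vecCons b s)) with hM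
  set N : Matrix (Fin (m + 2)) (Fin (m + 2)) R := of (vecCons 0 (vecCons d s)) with hN
  have hupd : ∀ v, N.updateRow 0 v = of (vecCons v (vecCons d s)) := by
    intro v
    ext i j
    refine Fin.cases ?_ (fun i => ?_) i <;> simp [hN, updateRow_apply]
  let L := (detRowAlternating (R := R) (n := Fin (m + 2))).toMultilinearMap.toLinearMap N 0
  have hL : ∀ v, L v = det (of (vecCons v (vecCons d s))) := by
    intro v
    rw [← hupd]
    rfl
  have key : M.det • c = ∑ j, (M.updateRow j c).det • M j := by
    have h := mulVec_cramer Mᵀ c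
    rw [det_transpose] at h
    rw [← h]
    ext i
    simp [mulVec, dotProduct, cramer_transpose_apply, Finset.sum_apply, mul_comm]
  have h2 := congrArg L key
  rw [map_smul, map_sum] at h2
  simp_rw [map_smul, hL, smul_eq_mul] at h2
  rw [h2, Fin.sum_univ_succ, Fin.sum_univ_succ]
  have e0 : M.updateRow 0 c = of (vecCons c (vecCons b s)) := by
    ext i j
    refine Fin.cases ?_ (fun i => ?_) i <;> simp [hM, updateRow_apply]
  have e1 : M.updateRow (Fin.succ 0) c = of (vecCons a (vecCons c s)) := by
    ext i j
    refine Fin.cases ?_ (fun i => Fin.cases ?_ (fun i => ?_) i) i <;>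
      simp [hM, updateRow_apply, Fin.ext_iff]
  have e2 : ∀ i : Fin m, det (of (vecCons (M i.succ.succ) (vecCons d s))) = 0 := by
    intro i
    refine det_zero_of_row_eq (i := 0) (j := i.succ.succ) (Fin.succ_ne_zero _).symm ?_
    ext j
    simp [hM]
  have hM0 : M 0 = a := rfl
  have hM1 : M (Fin.succ 0) = b := rfl
  simp only [e0, e1, e2, hM0, hM1, mul_zero, sum_const_zero, add_zero]

theorem vandermonde_det_cons {m : ℕ} (x : ℝ) (g : Fin m → ℝ) :
    det (vandermonde (vecCons x g)) = (∏ j, (g j - x)) * det (vandermonde g) := by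
  simp [det_vandermonde, Fin.prod_univ_succ, Fin.prod_Ioi_succ]

theorem pMinor_image_of_strictMono {k n : ℕ} (A : Matrix (Fin k) (Fin n) R) {f : Fin k → Fin n}
    (hf : StrictMono f) : pMinor A (univ.image f) = det (A.submatrix id f) := by
  have hc : (univ.image f).card = k := by
    rw [card_image_of_injective _ hf.injective, card_fin]
  rw [pMinor, dif_pos hc]
  have := Finset.orderEmbOfFin_unique hc (f := f) (fun x => by simp) hf
  congr 1
  ext r c
  rw [of_apply, coe_orderIsoOfFin_apply, ← this, submatrix_apply, id]

/-- The minor on an arbitrary injective list of columns is the sorted minor, up to the sign of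
the Vandermonde determinant of the list. -/
theorem det_submatrix_eq_sign_mul_pMinor {k n : ℕ} (A : Matrix (Fin k) (Fin n) ℝ)
    {f : Fin k → Fin n} (hf : Function.Injective f) :
    det (A.submatrix id f) =
      SignType.sign (det (vandermonde fun i => ((f i : ℕ) : ℝ))) * pMinor A (univ.image f) := by
  set σ := Tuple.sort f
  have hmono : StrictMono (f ∘ σ) :=
    (Tuple.monotone_sort f).strictMono_of_injective (hf.comp σ.injective)
  have himg : univ.image f = univ.image (f ∘ σ) := by
    rw [← image_image, image_univ_equiv]
  have hV : 0 < det (vandermonde fun i => ((f (σ i) : ℕ) : ℝ)) := by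
    rw [det_vandermonde]
    refine prod_pos fun i _ => prod_pos fun j hj => ?_
    have := hmono (mem_Ioi.1 hj)
    simpa [sub_pos] using this
  have h1 : det (vandermonde fun i => ((f (σ i) : ℕ) : ℝ)) =
      Equiv.Perm.sign σ * det (vandermonde fun i => ((f i : ℕ) : ℝ)) :=
    det_permute σ (vandermonde fun i => ((f i : ℕ) : ℝ))
  have h2 : det (A.submatrix id (f ∘ σ)) = Equiv.Perm.sign σ * det (A.submatrix id f) :=
    det_permute' σ (A.submatrix id f)
  rw [himg, pMinor_image_of_strictMono A hmono, h2]
  rw [h1] at hV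
  rcases Int.units_eq_one_or (Equiv.Perm.sign σ) with h | h
  · simp [h] at hV ⊢
    simp [hV]
  · simp [h] at hV ⊢
    simp [hV]

theorem exists_sign_pMinor_pair {k n : ℕ} (A : Matrix (Fin (k + 2)) (Fin n) ℝ)
    {S : Finset (Fin n)} (hS : S.card = k) :
    ∃ (ε : ℝ) (η : Fin n → ℝ), ε ^ 2 = 1 ∧ (∀ x ∉ S, η x ^ 2 = 1) ∧
      ∀ x y, x < y → x ∉ S → y ∉ S → pMinor A (S ∪ {x, y}) = ε * η x * η y *
        det (of (vecCons (Aᵀ x) (vecCons (Aᵀ y) fun i => Aᵀ (S.orderEmbOfFin hS i)))) := by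
  set g := S.orderEmbOfFin hS
  have hg : ∀ i, g i ∈ S := fun i => S.orderEmbOfFin_mem hS i
  have hsq : ∀ r : ℝ, r ≠ 0 → ((SignType.sign r : SignType) : ℝ) ^ 2 = 1 := by
    intro r hr
    rcases lt_or_gt_of_ne hr with h | h <;> simp [h]
  have hV0 : det (vandermonde fun i => ((g i : ℕ) : ℝ)) ≠ 0 := by
    rw [det_vandermonde_ne_zero_iff]
    intro i j h
    exact g.injective (Fin.ext (by simpa using h))
  have hη0 : ∀ x ∉ S, ∏ j, (((g j : ℕ) : ℝ) - ((x : ℕ) : ℝ)) ≠ 0 := by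
    intro x hx
    rw [prod_ne_zero_iff]
    intro j _ h
    refine hx ?_
    have : g j = x := Fin.ext (by exact_mod_cast sub_eq_zero.1 h)
    exact this ▸ hg j
  refine ⟨SignType.sign (det (vandermonde fun i => ((g i : ℕ) : ℝ))),
    fun x => SignType.sign (∏ j, (((g j : ℕ) : ℝ) - ((x : ℕ) : ℝ))), hsq _ hV0,
    fun x hx => hsq _ (hη0 x hx), fun x y hxy hx hy => ?_⟩
  set f : Fin (k + 2) → Fin n := vecCons x (vecCons y g) with hf
  have hfinj : Function.Injective f := by
    rw [hf]
    refine Fin.cons_injective_iff.2 ⟨?_, Fin.cons_injective_iff.2 ⟨?_, g.injective⟩⟩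
    · rintro ⟨i, hi⟩
      revert hi
      refine Fin.cases (fun h => hxy.ne' h) (fun i h => hx (h ▸ hg i)) i
    · rintro ⟨i, hi⟩
      exact hy (hi ▸ hg i)
  have himg : univ.image f = S ∪ {x, y} := by
    have : univ.image g = S := S.image_orderEmbOfFin_univ hS
    ext z
    rw [← this]
    simp [hf, Fin.exists_fin_succ]
    tauto
  have hdet : det (A.submatrix id f) =
      det (of (vecCons (Aᵀ x) (vecCons (Aᵀ y) fun i => Aᵀ (g i)))) := by
    rw [← det_transpose]
    congr 1
    ext i j
    refine Fin.cases ?_ (fun i => Fin.cases ?_ (fun i => ?_) i) i <;> simp [hf]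
  have h := det_submatrix_eq_sign_mul_pMinor A hfinj
  have hvec : (fun i => ((f i : ℕ) : ℝ)) =
      vecCons ((x : ℕ) : ℝ) (vecCons ((y : ℕ) : ℝ) fun i => ((g i : ℕ) : ℝ)) := by
    ext i
    refine Fin.cases ?_ (fun i => Fin.cases ?_ (fun i => ?_) i) i <;> simp [hf]
  have hpos : 0 < ((y : ℕ) : ℝ) - ((x : ℕ) : ℝ) := by
    simpa [sub_pos] using hxy
  rw [himg, hdet, hvec, vandermonde_det_cons, vandermonde_det_cons, Fin.prod_univ_succ] at h
  simp only [cons_val_zero, cons_val_succ, sign_mul, sign_pos hpos, one_mul] at h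
  rw [h]
  push_cast
  linear_combination
    (-(pMinor A (S ∪ {x, y}))) * ((hsq _ hV0) *
        ((SignType.sign (∏ j, (((g j : ℕ) : ℝ) - ((x : ℕ) : ℝ))) : SignType) : ℝ) ^ 2 *
        ((SignType.sign (∏ j, (((g j : ℕ) : ℝ) - ((y : ℕ) : ℝ))) : SignType) : ℝ) ^ 2 +
      (hsq _ (hη0 x hx)) *
        ((SignType.sign (∏ j, (((g j : ℕ) : ℝ) - ((y : ℕ) : ℝ))) : SignType) : ℝ) ^ 2 +
      hsq _ (hη0 y hy))

theorem pMinor_threeTerm {k n : ℕ} (A : Matrix (Fin k) (Fin n) ℝ) {S : Finset (Fin n)}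
    (hS : S.card + 2 = k) {a b c d : Fin n} (hab : a < b) (hbc : b < c) (hcd : c < d)
    (ha : a ∉ S) (hb : b ∉ S) (hc : c ∉ S) (hd : d ∉ S) :
    pMinor A (S ∪ {a, c}) * pMinor A (S ∪ {b, d}) =
      pMinor A (S ∪ {a, b}) * pMinor A (S ∪ {c, d}) +
      pMinor A (S ∪ {a, d}) * pMinor A (S ∪ {b, c}) := by
  obtain rfl := hS
  obtain ⟨ε, η, -, -, h⟩ := exists_sign_pMinor_pair A (S := S) rfl
  rw [h a c (hab.trans hbc) ha hc, h b d (hbc.trans hcd) hb hd, h a b hab ha hb,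
    h c d hcd hc hd, h a d (hab.trans (hbc.trans hcd)) ha hd, h b c hbc hb hc]
  have hr := det_vecCons_threeTerm (fun i => Aᵀ (S.orderEmbOfFin rfl i)) (Aᵀ a) (Aᵀ b) (Aᵀ c) (Aᵀ d)
  have hswap : det (of (vecCons (Aᵀ c) (vecCons (Aᵀ b) fun i => Aᵀ (S.orderEmbOfFin rfl i)))) =
      - det (of (vecCons (Aᵀ b) (vecCons (Aᵀ c) fun i => Aᵀ (S.orderEmbOfFin rfl i)))) := by
    rw [← neg_eq_iff_eq_neg]
    have h := det_permute (Equiv.swap 0 1)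
      (of (vecCons (Aᵀ c) (vecCons (Aᵀ b) fun i => Aᵀ (S.orderEmbOfFin rfl i))))
    rw [Equiv.Perm.sign_swap (by simp)] at h
    have h' : (of (vecCons (Aᵀ c) (vecCons (Aᵀ b) fun i => Aᵀ (S.orderEmbOfFin rfl i)))).submatrix
        (Equiv.swap 0 1) id =
        of (vecCons (Aᵀ b) (vecCons (Aᵀ c) fun i => Aᵀ (S.orderEmbOfFin rfl i))) := by
      ext i j
      refine Fin.cases ?_ (fun i => Fin.cases ?_ (fun i => ?_) i) i
      · simp
      · simp
      · rw [submatrix_apply, Equiv.swap_apply_of_ne_of_ne]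
        · simp
        · exact Fin.succ_ne_zero _
        · simp [Fin.ext_iff]
    rw [h'] at h
    rw [h]
    simp
  rw [hswap] at hr
  linear_combination (-(ε ^ 2 * η a * η b * η c * η d)) * hr

end PluckerRelations

/-- `f s` behaves like a positive multiple of `exp (-s * a)` as `s → ∞`. -/
def HasExpOrder (f : ℝ → ℝ) (a : ℝ) : Prop :=
  ∃ c > 0, Tendsto (fun s => Real.exp (s * a) * f s) atTop (𝓝 c)

namespace HasExpOrder

variable {f g : ℝ → ℝ} {a b : ℝ}

theorem eventually_pos (hf : HasExpOrder f a) : ∀ᶠ s in atTop, 0 < f s := by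
  obtain ⟨c, hc, h⟩ := hf
  filter_upwards [h.eventually (lt_mem_nhds hc)] with s hs
  exact pos_of_mul_pos_right hs (Real.exp_pos _).le

theorem congr' (hf : HasExpOrder f a) (h : f =ᶠ[atTop] g) : HasExpOrder g a := by
  obtain ⟨c, hc, hl⟩ := hf
  refine ⟨c, hc, hl.congr' ?_⟩
  filter_upwards [h] with s hs
  rw [hs]

theorem mul (hf : HasExpOrder f a) (hg : HasExpOrder g b) :
    HasExpOrder (fun s => f s * g s) (a + b) := by
  obtain ⟨c, hc, hf⟩ := hf
  obtain ⟨d, hd, hg⟩ := hg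
  refine ⟨c * d, mul_pos hc hd, (hf.mul hg).congr fun s => ?_⟩
  rw [mul_add, Real.exp_add]
  ring

theorem tendsto_of_lt (hf : HasExpOrder f a) (hb : b < a) :
    Tendsto (fun s => Real.exp (s * b) * f s) atTop (𝓝 0) := by
  obtain ⟨c, -, hf⟩ := hf
  have h : Tendsto (fun s : ℝ => Real.exp (s * (b - a))) atTop (𝓝 0) :=
    Real.tendsto_exp_atBot.comp (tendsto_id.atTop_mul_const_of_neg (by linarith))
  have h2 := h.mul hf
  rw [zero_mul] at h2
  refine h2.congr fun s => ?_
  rw [← mul_assoc, ← Real.exp_add]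
  ring_nf

theorem add (hf : HasExpOrder f a) (hg : HasExpOrder g b) :
    HasExpOrder (fun s => f s + g s) (min a b) := by
  rcases lt_trichotomy a b with h | h | h
  · have h0 := hg.tendsto_of_lt h
    obtain ⟨c, hc, hf⟩ := hf
    rw [min_eq_left h.le]
    refine ⟨c, hc, ?_⟩
    simpa [mul_add] using hf.add h0
  · subst h
    obtain ⟨c, hc, hf⟩ := hf
    obtain ⟨d, hd, hg⟩ := hg
    rw [min_self]
    refine ⟨c + d, add_pos hc hd, ?_⟩
    simpa [mul_add] using hf.add hg
  · have h0 := hf.tendsto_of_lt h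
    obtain ⟨c, hc, hg⟩ := hg
    rw [min_eq_right h.le]
    refine ⟨c, hc, ?_⟩
    simpa [mul_add] using h0.add hg

theorem of_mul_left (hf : HasExpOrder f a) (hfg : HasExpOrder (fun s => f s * g s) (a + b)) :
    HasExpOrder g b := by
  have hpos := hf.eventually_pos
  obtain ⟨c, hc, hf⟩ := hf
  obtain ⟨d, hd, hfg⟩ := hfg
  refine ⟨d / c, div_pos hd hc, (hfg.div hf hc.ne').congr' ?_⟩
  filter_upwards [hpos] with s hs
  have := Real.exp_pos (s * a)
  rw [Pi.div_apply, mul_add, Real.exp_add]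
  field_simp

end HasExpOrder

section FacesToPlucker

/-- The faces of the subdivision restricted to the subsets `J` with `S ⊆ J ⊆ S ∪ T` are
(traces of) faces of the whole subdivision. -/
theorem exists_mem_faceOf_iff {n k : ℕ} (P : Finset (Fin n) → ℝ) (S T : Finset (Fin n))
    (μ : Fin n → ℝ) : ∃ lam : Fin n → ℝ, ∀ I, I.card = k → S ⊆ I → I ⊆ S ∪ T →
      (I ∈ FaceOf n k P lam ↔ ∀ J : Finset (Fin n), J.card = k → S ⊆ J → J ⊆ S ∪ T →
        (∑ i ∈ J, μ i) - P J ≤ (∑ i ∈ I, μ i) - P I) := by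
  obtain ⟨C, hC⟩ : ∃ C, ∀ J : Finset (Fin n), |(∑ i ∈ J, μ i) - P J| ≤ C := by
    obtain ⟨C, hC⟩ := (Set.finite_range fun J : Finset (Fin n) =>
      |(∑ i ∈ J, μ i) - P J|).bddAbove
    exact ⟨C, fun J => hC ⟨J, rfl⟩⟩
  let h : Fin n → ℝ := fun i => (if i ∈ S then 1 else 0) - (if i ∈ S ∪ T then 0 else 1)
  have hsum : ∀ J : Finset (Fin n), ∑ i ∈ J, h i = ((J ∩ S).card : ℝ) - (J \ (S ∪ T)).card := by
    intro J
    simp only [h, sum_sub_distrib]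
    congr 1
    · rw [sum_ite_mem]
      simp
    · simp [sum_ite, sdiff_eq_filter]
  have hgood : ∀ J : Finset (Fin n), S ⊆ J → J ⊆ S ∪ T → ∑ i ∈ J, h i = S.card := by
    intro J h1 h2
    rw [hsum, inter_eq_right.2 h1, sdiff_eq_empty_iff_subset.2 h2]
    simp
  have hbad : ∀ J : Finset (Fin n), ¬ (S ⊆ J ∧ J ⊆ S ∪ T) → ∑ i ∈ J, h i ≤ S.card - 1 := by
    intro J hJ
    rw [hsum]
    by_cases h1 : S ⊆ J
    · have h2 : (J \ (S ∪ T)).Nonempty := by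
        rw [nonempty_iff_ne_empty, ne_eq, sdiff_eq_empty_iff_subset]
        exact fun h2 => hJ ⟨h1, h2⟩
      have h3 : (1 : ℝ) ≤ (J \ (S ∪ T)).card := by exact_mod_cast h2.card_pos
      have h4 : ((J ∩ S).card : ℝ) ≤ S.card := by exact_mod_cast card_le_card inter_subset_right
      linarith
    · have h2 : (J ∩ S).card < S.card := by
        refine card_lt_card ⟨inter_subset_right, fun h2 => h1 fun x hx => ?_⟩
        exact (mem_inter.1 (h2 hx)).1
      have h3 : ((J ∩ S).card : ℝ) + 1 ≤ S.card := by exact_mod_cast h2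
      have h4 : (0 : ℝ) ≤ (J \ (S ∪ T)).card := Nat.cast_nonneg _
      linarith
  have hC0 : 0 ≤ C := (abs_nonneg _).trans (hC ∅)
  refine ⟨fun i => (2 * C + 1) * h i + μ i, fun I hI hSI hIT => ?_⟩
  simp only [FaceOf, Set.mem_ofPred_eq, sum_add_distrib, ← mul_sum, hI, true_and, hgood I hSI hIT]
  refine ⟨fun H J hJ h1 h2 => ?_, fun H J hJ => ?_⟩
  · have := H J hJ
    rw [hgood J h1 h2] at this
    linarith
  · by_cases hJ' : S ⊆ J ∧ J ⊆ S ∪ T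
    · have := H J hJ hJ'.1 hJ'.2
      rw [hgood J hJ'.1 hJ'.2]
      linarith
    · have h1 := mul_le_mul_of_nonneg_left (hbad J hJ') (by linarith : 0 ≤ 2 * C + 1)
      have h2 := abs_le.1 (hC I)
      have h3 := abs_le.1 (hC J)
      linarith

theorem isPosTropPlucker_of_faceOf {n k : ℕ} {P : Finset (Fin n) → ℝ}
    (H : ∀ lam, IsPositroidFamily n k (FaceOf n k P lam)) : IsPosTropPlucker n k P := by
  intro S hS a b c d hab hbc hcd ha hb hc hd
  set X := P (S ∪ {a, c}) + P (S ∪ {b, d}) with hX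
  set Y := P (S ∪ {a, b}) + P (S ∪ {c, d}) with hY
  set Z := P (S ∪ {a, d}) + P (S ∪ {b, c}) with hZ
  have hac := hab.trans hbc
  have hbd := hbc.trans hcd
  have had := hab.trans hbd
  let α := P (S ∪ {a, c}) - P (S ∪ {b, d})
  let β := P (S ∪ {a, b}) - P (S ∪ {c, d})
  let γ := P (S ∪ {a, d}) - P (S ∪ {b, c})
  let μ : Fin n → ℝ := fun i => if i = b then -(α + γ) / 2 else
    if i = c then -(β + γ) / 2 else if i = d then -(α + β) / 2 else 0
  have hμa : μ a = 0 := by simp [μ, hab.ne, hac.ne, had.ne]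
  have hμb : μ b = -(α + γ) / 2 := by simp [μ]
  have hμc : μ c = -(β + γ) / 2 := by simp [μ, hbc.ne']
  have hμd : μ d = -(α + β) / 2 := by simp [μ, hbd.ne', hcd.ne']
  have hμS : ∑ i ∈ S, μ i = 0 := by
    refine sum_eq_zero fun i hi => ?_
    have h1 : i ≠ b := fun h => hb (h ▸ hi)
    have h2 : i ≠ c := fun h => hc (h ▸ hi)
    have h3 : i ≠ d := fun h => hd (h ▸ hi)
    simp [μ, h1, h2, h3]
  have hdisj : ∀ x y, x ∉ S → y ∉ S → Disjoint S {x, y} := by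
    intro x y hx hy
    simp [hx, hy]
  have hsum : ∀ x y, x < y → x ∉ S → y ∉ S → ∑ i ∈ S ∪ {x, y}, μ i = μ x + μ y := by
    intro x y hxy hx hy
    rw [sum_union (hdisj x y hx hy), hμS, zero_add, sum_pair hxy.ne]
  have hcard : ∀ x y, x < y → x ∉ S → y ∉ S → (S ∪ {x, y}).card = k := by
    intro x y hxy hx hy
    rw [card_union_of_disjoint (hdisj x y hx hy), card_pair hxy.ne, hS]
  set T : Finset (Fin n) := {a, b, c, d} with hT
  obtain ⟨lam, hlam⟩ := exists_mem_faceOf_iff (k := k) P S T μ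
  have hsix : ∀ J : Finset (Fin n), J.card = k → S ⊆ J → J ⊆ S ∪ T →
      J = S ∪ {a, b} ∨ J = S ∪ {a, c} ∨ J = S ∪ {a, d} ∨ J = S ∪ {b, c} ∨
      J = S ∪ {b, d} ∨ J = S ∪ {c, d} := by
    intro J hJ hSJ hJT
    have h2 : (J \ S).card = 2 := by
      rw [card_sdiff_of_subset hSJ]
      lia
    obtain ⟨x, y, hxy, hJxy⟩ := card_eq_two.1 h2
    have hJ' : J = S ∪ {x, y} := by rw [← hJxy, union_sdiff_of_subset hSJ]
    have hxyT : ({x, y} : Finset (Fin n)) ⊆ T := by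
      rw [← hJxy]
      exact sdiff_le_iff.2 hJT
    have hx : x ∈ T := hxyT (by simp)
    have hy : y ∈ T := hxyT (by simp)
    rw [hT] at hx hy
    simp only [mem_insert, mem_singleton] at hx hy
    rw [hJ']
    rcases hx with rfl | rfl | rfl | rfl <;> rcases hy with rfl | rfl | rfl | rfl <;>
      first
      | exact absurd rfl hxy
      | (simp; done)
      | (rw [pair_comm]; simp)
  have hval : ∀ J : Finset (Fin n), J.card = k → S ⊆ J → J ⊆ S ∪ T →
      ∀ m, X ≥ m → Y ≥ m → Z ≥ m → (∑ i ∈ J, μ i) - P J ≤ -(α + β + γ) / 2 - m / 2 := by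
    intro J hJ hSJ hJT m h1 h2 h3
    rcases hsix J hJ hSJ hJT with rfl | rfl | rfl | rfl | rfl | rfl <;>
      rw [hsum _ _ (by assumption) (by assumption) (by assumption)] <;>
      simp only [hμa, hμb, hμc, hμd, α, β, γ] <;> linarith
  have hmem : ∀ x y, x < y → x ∈ T → y ∈ T → x ∉ S → y ∉ S → ∀ m,
      μ x + μ y - P (S ∪ {x, y}) = -(α + β + γ) / 2 - m / 2 →
      (S ∪ {x, y} ∈ FaceOf n k P lam ↔ m ≤ X ∧ m ≤ Y ∧ m ≤ Z) := by
    intro x y hxy hxT hyT hx hy m hm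
    have hsub : ∀ x y, x ∈ T → y ∈ T → S ∪ {x, y} ⊆ S ∪ T := fun x y hx hy =>
      union_subset_union_right (by simp [insert_subset_iff, hx, hy])
    rw [hlam _ (hcard x y hxy hx hy) subset_union_left (hsub x y hxT hyT), hsum x y hxy hx hy, hm]
    refine ⟨fun h => ⟨?_, ?_, ?_⟩, fun h J hJ hSJ hJT => hval J hJ hSJ hJT m h.1 h.2.1 h.2.2⟩
    · have := h _ (hcard a c hac ha hc) subset_union_left (hsub a c (by simp [hT]) (by simp [hT]))
      rw [hsum a c hac ha hc, hμa, hμc] at this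
      simp only [α, β, γ] at this
      linarith
    · have := h _ (hcard a b hab ha hb) subset_union_left (hsub a b (by simp [hT]) (by simp [hT]))
      rw [hsum a b hab ha hb, hμa, hμb] at this
      simp only [α, β, γ] at this
      linarith
    · have := h _ (hcard a d had ha hd) subset_union_left (hsub a d (by simp [hT]) (by simp [hT]))
      rw [hsum a d had ha hd, hμa, hμd] at this
      simp only [α, β, γ] at this
      linarith
  obtain ⟨A, hA0, hA⟩ := H lam
  have hne : ∀ x y, x < y → x ∈ T → y ∈ T → x ∉ S → y ∉ S → ∀ m,
      μ x + μ y - P (S ∪ {x, y}) = -(α + β + γ) / 2 - m / 2 →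
      0 ≤ pMinor A (S ∪ {x, y}) ∧ (pMinor A (S ∪ {x, y}) ≠ 0 ↔ m ≤ X ∧ m ≤ Y ∧ m ≤ Z) := by
    intro x y hxy hxT hyT hx hy m hm
    have hc := hcard x y hxy hx hy
    refine ⟨hA0 _ hc, ?_⟩
    rw [← hmem x y hxy hxT hyT hx hy m hm, hA]
    exact (and_iff_right hc).symm
  have h3 := pMinor_threeTerm A hS hab hbc hcd ha hb hc hd
  obtain ⟨ac0, ac⟩ := hne a c hac (by simp [hT]) (by simp [hT]) ha hc X
    (by simp only [hμa, hμc, hX, α, β, γ]; ring)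
  obtain ⟨bd0, bd⟩ := hne b d hbd (by simp [hT]) (by simp [hT]) hb hd X
    (by simp only [hμb, hμd, hX, α, β, γ]; ring)
  obtain ⟨ab0, ab⟩ := hne a b hab (by simp [hT]) (by simp [hT]) ha hb Y
    (by simp only [hμa, hμb, hY, α, β, γ]; ring)
  obtain ⟨cd0, cd⟩ := hne c d hcd (by simp [hT]) (by simp [hT]) hc hd Y
    (by simp only [hμc, hμd, hY, α, β, γ]; ring)
  obtain ⟨ad0, ad⟩ := hne a d had (by simp [hT]) (by simp [hT]) ha hd Z
    (by simp only [hμa, hμd, hZ, α, β, γ]; ring)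
  obtain ⟨bc0, bc⟩ := hne b c hbc (by simp [hT]) (by simp [hT]) hb hc Z
    (by simp only [hμb, hμc, hZ, α, β, γ]; ring)
  have hYZ : (Y ≤ X ∧ Y ≤ Z) ∨ (Z ≤ X ∧ Z ≤ Y) := by
    by_contra hcon
    have hXmin : X ≤ X ∧ X ≤ Y ∧ X ≤ Z := by grind
    have hlt := mul_pos (ac0.lt_of_ne' (ac.2 hXmin)) (bd0.lt_of_ne' (bd.2 hXmin))
    have hab' : pMinor A (S ∪ {a, b}) = 0 := by
      by_contra h
      exact hcon (Or.inl ⟨(ab.1 h).1, (ab.1 h).2.2⟩)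
    have had' : pMinor A (S ∪ {a, d}) = 0 := by
      by_contra h
      exact hcon (Or.inr ⟨(ad.1 h).1, (ad.1 h).2.1⟩)
    rw [h3, hab', had'] at hlt
    simp at hlt
  rcases hYZ with ⟨h1, h2⟩ | ⟨h1, h2⟩
  · have hY' : Y ≤ X ∧ Y ≤ Y ∧ Y ≤ Z := ⟨h1, le_rfl, h2⟩
    have hlt := mul_pos (ab0.lt_of_ne' (ab.2 hY')) (cd0.lt_of_ne' (cd.2 hY'))
    have hge := mul_nonneg ad0 bc0
    have hX' := ac.1 (left_ne_zero_of_mul (b := pMinor A (S ∪ {b, d})) (by rw [h3]; linarith))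
    exact Or.inl ⟨le_antisymm hX'.2.1 h1, h2⟩
  · have hZ' : Z ≤ X ∧ Z ≤ Y ∧ Z ≤ Z := ⟨h1, h2, le_rfl⟩
    have hlt := mul_pos (ad0.lt_of_ne' (ad.2 hZ')) (bc0.lt_of_ne' (bc.2 hZ'))
    have hge := mul_nonneg ab0 cd0
    have hX' := ac.1 (left_ne_zero_of_mul (b := pMinor A (S ∪ {b, d})) (by rw [h3]; linarith))
    exact Or.inr ⟨le_antisymm hX'.2.2 h1, h2⟩

end FacesToPlucker

section Construction

/-- The matrix with first row `(1, x)`, first column `(1, 0, …, 0)` and remaining block `A`. -/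
def bordered {k n : ℕ} (x : Fin n → ℝ) (A : Matrix (Fin k) (Fin n) ℝ) :
    Matrix (Fin (k + 1)) (Fin (n + 1)) ℝ :=
  of (vecCons (vecCons 1 x) fun i => vecCons 0 (A i))

/-- The increasing list of the `k + 1` consecutive elements of `Fin n` ending at `c`. -/
def consecutive {k n : ℕ} (c : Fin n) (h : k ≤ c) (i : Fin (k + 1)) : Fin n :=
  ⟨c - k + i, by lia⟩

theorem strictMono_consecutive {k n : ℕ} (c : Fin n) (h : k ≤ c) :
    StrictMono (consecutive c h) := by
  exact fun i j hij => Fin.mk_lt_mk.2 (Nat.add_lt_add_left hij _)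

theorem pMinor_bordered_insert_zero {k n : ℕ} (x : Fin n → ℝ) (A : Matrix (Fin k) (Fin n) ℝ)
    {I : Finset (Fin n)} (hI : I.card = k) :
    pMinor (bordered x A) (insert 0 (I.map (Fin.succEmb n))) = pMinor A I := by
  set g := I.orderEmbOfFin hI
  have hg : univ.image g = I := I.image_orderEmbOfFin_univ hI
  have hmono : StrictMono (vecCons 0 (Fin.succ ∘ g) : Fin (k + 1) → Fin (n + 1)) := by
    intro i j
    refine Fin.cases ?_ (fun i => ?_) i <;> refine Fin.cases ?_ (fun j => ?_) j <;> simp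
  have himg : insert 0 (I.map (Fin.succEmb n)) =
      univ.image (vecCons 0 (Fin.succ ∘ g) : Fin (k + 1) → Fin (n + 1)) := by
    have hmem : ∀ y, y ∈ I ↔ ∃ i, g i = y := fun y => by
      simpa using (Finset.ext_iff.1 hg y).symm
    ext z
    simp [hmem, Fin.exists_fin_succ, eq_comm (a := z)]
  rw [himg, pMinor_image_of_strictMono _ hmono, ← hg, pMinor_image_of_strictMono _ g.strictMono,
    det_succ_column_zero, Fin.sum_univ_succ]
  have h0 : ∀ i : Fin k, (bordered x A).submatrix id (vecCons 0 (Fin.succ ∘ g)) i.succ 0 = 0 := by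
    intro i
    simp [bordered]
  simp only [h0, mul_zero, zero_mul, sum_const_zero, add_zero]
  have h1 : ((bordered x A).submatrix id (vecCons 0 (Fin.succ ∘ g))).submatrix
      (Fin.succAbove 0) Fin.succ = A.submatrix id g := by
    ext i j
    simp [bordered]
  rw [h1]
  simp [bordered]

theorem det_bordered_submatrix_succ {k n : ℕ} (x : Fin n → ℝ) (A : Matrix (Fin k) (Fin n) ℝ)
    (f : Fin (k + 1) → Fin n) :
    det ((bordered x A).submatrix id (Fin.succ ∘ f)) =
      ∑ i : Fin (k + 1), (-1) ^ (i : ℕ) * x (f i) * det (A.submatrix id (f ∘ i.succAbove)) := by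
  rw [det_succ_row_zero]
  refine sum_congr rfl fun i _ => ?_
  have h1 : ((bordered x A).submatrix id (Fin.succ ∘ f)).submatrix Fin.succ i.succAbove =
      A.submatrix id (f ∘ i.succAbove) := by
    ext i j
    simp [bordered]
  rw [h1]
  simp [bordered]

/-- The first row of a bordered matrix can be chosen so as to prescribe its minors on consecutive
columns. -/
theorem exists_bordered_minors_eq {k n : ℕ} (A : Matrix (Fin k) (Fin n) ℝ)
    (t : ∀ c : Fin n, k ≤ c → ℝ) :
    ∃ x : Fin n → ℝ, ∀ (c : Fin n) (h : k ≤ c),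
      det (A.submatrix id (consecutive c h ∘ Fin.castSucc)) ≠ 0 →
      det ((bordered x A).submatrix id (Fin.succ ∘ consecutive c h)) = t c h := by
  suffices H : ∀ m : ℕ, ∃ x : Fin n → ℝ, ∀ (c : Fin n) (h : k ≤ c), (c : ℕ) < m →
      det (A.submatrix id (consecutive c h ∘ Fin.castSucc)) ≠ 0 →
      det ((bordered x A).submatrix id (Fin.succ ∘ consecutive c h)) = t c h by
    obtain ⟨x, hx⟩ := H n
    exact ⟨x, fun c h => hx c h c.2⟩
  intro m
  induction m with
  | zero => exact ⟨0, fun c h hc => absurd hc (Nat.not_lt_zero _)⟩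
  | succ m ih =>
    obtain ⟨x, hx⟩ := ih
    by_cases hm : m < n ∧ k ≤ m
    swap
    · exact ⟨x, fun c h hc => hx c h (by lia)⟩
    obtain ⟨hmn, hkm⟩ := hm
    set e : Fin n := ⟨m, hmn⟩ with he
    set α := det (A.submatrix id (consecutive e hkm ∘ Fin.castSucc)) with hα
    set β := ∑ i : Fin k, (-1) ^ (i : ℕ) * x (consecutive e hkm i.castSucc) *
      det (A.submatrix id (consecutive e hkm ∘ i.castSucc.succAbove)) with hβ
    refine ⟨Function.update x e ((-1) ^ k * (t e hkm - β) / α), fun c h hc hne => ?_⟩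
    rw [det_bordered_submatrix_succ]
    rcases Nat.lt_succ_iff_lt_or_eq.1 hc with hlt | heq
    · rw [← hx c h hlt hne, det_bordered_submatrix_succ]
      refine sum_congr rfl fun i _ => ?_
      rw [Function.update_of_ne]
      intro h'
      have h2 := congrArg Fin.val h'
      simp only [consecutive, he] at h2
      lia
    · obtain rfl : c = e := Fin.ext heq
      have hlast : consecutive e hkm (Fin.last k) = e := by
        ext
        simp only [consecutive, Fin.val_last]
        lia
      rw [Fin.sum_univ_castSucc, hlast, Function.update_self, Fin.succAbove_last]
      have hrest : ∑ i : Fin k, (-1) ^ (i.castSucc : ℕ) *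
          Function.update x e ((-1) ^ k * (t e hkm - β) / α) (consecutive e hkm i.castSucc) *
          det (A.submatrix id (consecutive e hkm ∘ i.castSucc.succAbove)) = β := by
        rw [hβ]
        refine sum_congr rfl fun i _ => ?_
        rw [Function.update_of_ne, Fin.val_castSucc]
        have hlt := strictMono_consecutive e hkm (Fin.castSucc_lt_last i)
        rw [hlast] at hlt
        exact hlt.ne
      have hsq : ((-1 : ℝ) ^ k) * (-1) ^ k = 1 := by
        rw [← mul_pow]
        simp
      have hα0 : α ≠ 0 := hne
      rw [hrest, Fin.val_last]
      change β + (-1) ^ k * ((-1) ^ k * (t e hkm - β) / α) * α = t e hkm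
      field_simp
      linear_combination (t e hkm - β) * hsq

theorem IsPosTropPlucker.contract {n k : ℕ} {P : Finset (Fin (n + 1)) → ℝ}
    (hP : IsPosTropPlucker (n + 1) (k + 1) P) :
    IsPosTropPlucker n k fun I => P (insert 0 (I.map (Fin.succEmb n))) := by
  intro S hS a b c d hab hbc hcd ha hb hc hd
  have h0 : (0 : Fin (n + 1)) ∉ S.map (Fin.succEmb n) := by simp
  have hmem : ∀ x : Fin n, x ∉ S → x.succ ∉ insert 0 (S.map (Fin.succEmb n)) := by
    intro x hx
    simp [hx]
  have hun : ∀ x y : Fin n, insert 0 ((S ∪ {x, y}).map (Fin.succEmb n)) =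
      insert 0 (S.map (Fin.succEmb n)) ∪ {x.succ, y.succ} := by
    intro x y
    rw [map_union, insert_union]
    simp
  have h := hP (insert 0 (S.map (Fin.succEmb n)))
    (by rw [card_insert_of_notMem h0, card_map]; lia) a.succ b.succ c.succ d.succ
    (by simpa) (by simpa) (by simpa) (hmem a ha) (hmem b hb) (hmem c hc) (hmem d hd)
  simpa only [hun] using h

theorem IsPosTropPlucker.eq_min {n k : ℕ} {P : Finset (Fin n) → ℝ} (hP : IsPosTropPlucker n k P)
    {S : Finset (Fin n)} (hS : S.card + 2 = k) {a b c d : Fin n} (hab : a < b) (hbc : b < c)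
    (hcd : c < d) (ha : a ∉ S) (hb : b ∉ S) (hc : c ∉ S) (hd : d ∉ S) :
    P (S ∪ {a, c}) + P (S ∪ {b, d}) =
      min (P (S ∪ {a, b}) + P (S ∪ {c, d})) (P (S ∪ {a, d}) + P (S ∪ {b, c})) := by
  rcases hP S hS a b c d hab hbc hcd ha hb hc hd with ⟨h1, h2⟩ | ⟨h1, h2⟩
  · rw [h1, min_eq_left h2]
  · rw [h1, min_eq_right h2]

/-- Asymptotics of the minors propagate along the three-term relations from the subsets containing
`0` and the sets of consecutive elements to all subsets. -/
theorem hasExpOrder_pMinor_of_consecutive {n k : ℕ} {P : Finset (Fin (n + 1)) → ℝ} {r : ℝ}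
    (hP : IsPosTropPlucker (n + 1) (k + 1) P) (B : ℝ → Matrix (Fin (k + 1)) (Fin (n + 1)) ℝ)
    (hzero : ∀ I : Finset (Fin (n + 1)), I.card = k + 1 → 0 ∈ I →
      HasExpOrder (fun s => pMinor (B s) I) (P I - r))
    (hcons : ∀ (c : Fin n) (h : k ≤ c), HasExpOrder
      (fun s => pMinor (B s) (univ.image (Fin.succ ∘ consecutive c h)))
      (P (univ.image (Fin.succ ∘ consecutive c h)) - r))
    (I : Finset (Fin (n + 1))) (hI : I.card = k + 1) :
    HasExpOrder (fun s => pMinor (B s) I) (P I - r) := by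
  by_cases h0I : 0 ∈ I
  · exact hzero I hI h0I
  suffices H : ∀ N b : ℕ, ∀ I : Finset (Fin (n + 1)), I.card = k + 1 → 0 ∉ I →
      (∀ i ∈ I, b ≤ (i : ℕ) ∧ (i : ℕ) ≤ b + N) →
      HasExpOrder (fun s => pMinor (B s) I) (P I - r) from
    H n 0 I hI h0I fun i _ => ⟨Nat.zero_le _, by lia⟩
  clear hI h0I I
  have hfull : ∀ N b : ℕ, ∀ I : Finset (Fin (n + 1)), I.card = k + 1 → 0 ∉ I →
      (∀ i ∈ I, b ≤ (i : ℕ) ∧ (i : ℕ) ≤ b + N) →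
      (∀ m, b ≤ m → m ≤ b + N → ∃ i ∈ I, (i : ℕ) = m) →
      HasExpOrder (fun s => pMinor (B s) I) (P I - r) := by
    intro N b I hI h0 hb hall
    have hIcc : I.map Fin.valEmbedding = Icc b (b + N) := by
      ext m
      simp only [Finset.mem_map, Fin.valEmbedding_apply, mem_Icc]
      refine ⟨?_, fun h => hall m h.1 h.2⟩
      rintro ⟨i, hi, rfl⟩
      exact hb i hi
    have hN : N = k := by
      have h := congrArg Finset.card hIcc
      rw [card_map, hI, Nat.card_Icc] at h
      lia
    subst hN
    obtain ⟨i, hi, hib⟩ := hall b le_rfl (Nat.le_add_right _ _)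
    obtain ⟨j, hj, hjb⟩ := hall (b + N) (Nat.le_add_right _ _) le_rfl
    have hb0 : b ≠ 0 := fun h => h0 ((Fin.ext (hib.trans h) : i = 0) ▸ hi)
    have hcn : b + N - 1 < n := by lia
    have hNc : N ≤ b + N - 1 := by lia
    have hImg : I = univ.image (Fin.succ ∘ consecutive (⟨b + N - 1, hcn⟩ : Fin n) hNc) := by
      symm
      refine eq_of_subset_of_card_le (fun z hz => ?_) ?_
      · obtain ⟨l, -, rfl⟩ := mem_image.1 hz
        obtain ⟨y, hy, hyv⟩ := hall (b + l) (Nat.le_add_right _ _) (by lia)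
        convert hy
        ext
        simp only [Function.comp_apply, consecutive, Fin.val_succ]
        lia
      · rw [hI, card_image_of_injective _
          ((Fin.succ_injective _).comp (strictMono_consecutive _ _).injective), card_fin]
    rw [hImg]
    exact hcons _ _
  intro N
  induction N with
  | zero =>
    intro b I hI h0 hb
    obtain ⟨i, hi⟩ : I.Nonempty := card_pos.1 (by lia)
    exact hfull 0 b I hI h0 hb fun m h1 h2 => ⟨i, hi, by have := hb i hi; lia⟩
  | succ N ih =>
    intro b I hI h0 hb
    by_cases hleft : ∃ i ∈ I, (i : ℕ) = b
    swap
    · push Not at hleft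
      refine ih (b + 1) I hI h0 fun i hi => ?_
      have h1 := hb i hi
      have h2 := hleft i hi
      lia
    by_cases hright : ∃ i ∈ I, (i : ℕ) = b + (N + 1)
    swap
    · push Not at hright
      refine ih b I hI h0 fun i hi => ?_
      have h1 := hb i hi
      have h2 := hright i hi
      lia
    by_cases hall : ∀ m, b ≤ m → m ≤ b + (N + 1) → ∃ i ∈ I, (i : ℕ) = m
    · exact hfull _ b I hI h0 hb hall
    push Not at hall
    obtain ⟨m, hm1, hm2, hm⟩ := hall
    obtain ⟨β, hβ, hβb⟩ := hleft
    obtain ⟨δ, hδ, hδb⟩ := hright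
    obtain ⟨γ, rfl⟩ : ∃ γ : Fin (n + 1), (γ : ℕ) = m := ⟨⟨m, by lia⟩, rfl⟩
    have hγ : γ ∉ I := fun h => hm γ h rfl
    have hβγ : β < γ := by
      have := hm β hβ
      lia
    have hγδ : γ < δ := by
      have := hm δ hδ
      lia
    have hβ0 : 0 < β := Fin.pos_iff_ne_zero.2 fun h => h0 (h ▸ hβ)
    set S := (I.erase β).erase δ with hS
    have hβδ : β < δ := hβγ.trans hγδ
    have hδ' : δ ∈ I.erase β := mem_erase.2 ⟨hβδ.ne', hδ⟩
    have hScard : S.card + 2 = k + 1 := by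
      have h1 := card_erase_add_one hδ'
      have h2 := card_erase_add_one hβ
      lia
    have hSI : ∀ i ∈ S, i ∈ I := fun i hi => mem_of_mem_erase (mem_of_mem_erase hi)
    have hS0 : 0 ∉ S := fun h => h0 (hSI 0 h)
    have hSβ : β ∉ S := by simp [hS]
    have hSγ : γ ∉ S := fun h => hγ (hSI γ h)
    have hSδ : δ ∉ S := by simp [hS]
    have hIS : I = S ∪ {β, δ} := by
      ext z
      simp only [hS, mem_union, mem_erase, mem_insert, mem_singleton]
      grind
    have hcard : ∀ x y, x < y → x ∉ S → y ∉ S → (S ∪ {x, y}).card = k + 1 := by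
      intro x y hxy hx hy
      rw [card_union_of_disjoint (by simp [hx, hy]), card_pair hxy.ne, hScard]
    have hz : ∀ y, 0 < y → y ∉ S →
        HasExpOrder (fun s => pMinor (B s) (S ∪ {0, y})) (P (S ∪ {0, y}) - r) :=
      fun y hy hyS => hzero _ (hcard 0 y hy hS0 hyS) (by simp)
    have hSb : ∀ i ∈ S, b < (i : ℕ) ∧ (i : ℕ) < b + (N + 1) := by
      intro i hi
      have h1 := hb i (hSI i hi)
      have h2 : (i : ℕ) ≠ b := fun h => hSβ ((Fin.ext (h.trans hβb.symm) : i = β) ▸ hi)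
      have h3 : (i : ℕ) ≠ b + (N + 1) := fun h => hSδ ((Fin.ext (h.trans hδb.symm) : i = δ) ▸ hi)
      lia
    have hβγ' : HasExpOrder (fun s => pMinor (B s) (S ∪ {β, γ})) (P (S ∪ {β, γ}) - r) := by
      refine ih b _ (hcard _ _ hβγ hSβ hSγ) (by simp [hS0, hβ0.ne, (hβ0.trans hβγ).ne]) ?_
      intro i hi
      simp only [mem_union, mem_insert, mem_singleton] at hi
      rcases hi with hi | rfl | rfl
      · have := hSb i hi
        lia
      · lia
      · lia
    have hγδ' : HasExpOrder (fun s => pMinor (B s) (S ∪ {γ, δ})) (P (S ∪ {γ, δ}) - r) := by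
      refine ih (b + 1) _ (hcard _ _ hγδ hSγ hSδ)
        (by simp [hS0, (hβ0.trans hβδ).ne, (hβ0.trans hβγ).ne]) ?_
      intro i hi
      simp only [mem_union, mem_insert, mem_singleton] at hi
      rcases hi with hi | rfl | rfl
      · have := hSb i hi
        lia
      · lia
      · lia
    have h0γ := hz γ (hβ0.trans hβγ) hSγ
    have hsum := ((hz β hβ0 hSβ).mul hγδ').add ((hz δ (hβ0.trans hβδ) hSδ).mul hβγ')
    have hmin := hP.eq_min hScard hβ0 hβγ hγδ hS0 hSβ hSγ hSδ
    rw [hIS]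
    refine h0γ.of_mul_left ?_
    have hexp : P (S ∪ {0, γ}) - r + (P (S ∪ {β, δ}) - r) =
        min (P (S ∪ {0, β}) - r + (P (S ∪ {γ, δ}) - r))
          (P (S ∪ {0, δ}) - r + (P (S ∪ {β, γ}) - r)) := by
      rw [show ∀ x y : ℝ, x - r + (y - r) = x + y - 2 * r by intros; ring,
        show ∀ x y : ℝ, x - r + (y - r) = x + y - 2 * r by intros; ring,
        show ∀ x y : ℝ, x - r + (y - r) = x + y - 2 * r by intros; ring, min_sub_sub_right, hmin]
    rw [hexp]
    exact hsum.congr' (Eventually.of_forall fun s =>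
      (pMinor_threeTerm (B s) hScard hβ0 hβγ hγδ hS0 hSβ hSγ hSδ).symm)

/-- A positive tropical Plücker vector is, up to an additive constant, the vector of exponents of
the minors of a one-parameter family of matrices with eventually positive minors. -/
theorem IsPosTropPlucker.exists_hasExpOrder {k : ℕ} : ∀ {n : ℕ} {P : Finset (Fin n) → ℝ},
    IsPosTropPlucker n k P → ∃ (r : ℝ) (A : ℝ → Matrix (Fin k) (Fin n) ℝ),
      ∀ I : Finset (Fin n), I.card = k → HasExpOrder (fun s => pMinor (A s) I) (P I - r) := by
  induction k with
  | zero =>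
    intro n P _
    refine ⟨P ∅, 0, fun I hI => ⟨1, one_pos, ?_⟩⟩
    obtain rfl := card_eq_zero.1 hI
    simp [pMinor]
  | succ k ih =>
    intro n P hP
    cases n with
    | zero =>
      refine ⟨0, 0, fun I hI => ?_⟩
      rw [eq_empty_of_isEmpty I, card_empty] at hI
      lia
    | succ n =>
      obtain ⟨r, A, hA⟩ := ih hP.contract
      choose x hx using fun s => exists_bordered_minors_eq (A s) fun c h =>
        Real.exp (-(s * (P (univ.image (Fin.succ ∘ consecutive c h)) - r)))
      refine ⟨r, fun s => bordered (x s) (A s), hasExpOrder_pMinor_of_consecutive hP _ ?_ ?_⟩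
      · intro I hI h0
        obtain ⟨J, rfl⟩ : ∃ J : Finset (Fin n), I = insert 0 (J.map (Fin.succEmb n)) := by
          refine ⟨univ.filter fun j => j.succ ∈ I, ?_⟩
          ext z
          refine Fin.cases ?_ (fun z => ?_) z <;> simp [h0]
        have hJ : J.card = k := by
          rw [card_insert_of_notMem (by simp), card_map] at hI
          lia
        simp only [pMinor_bordered_insert_zero _ _ hJ]
        exact hA J hJ
      · intro c h
        have hmono := (strictMono_consecutive c h).comp (Fin.strictMono_castSucc (n := k))
        have hpos := (hA _ ((card_image_of_injective univ hmono.injective).trans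
          (card_fin k))).eventually_pos
        refine ⟨1, one_pos, tendsto_const_nhds.congr' ?_⟩
        filter_upwards [hpos] with s hs
        rw [pMinor_image_of_strictMono _ hmono] at hs
        rw [pMinor_image_of_strictMono _ ((Fin.strictMono_succ (n := n)).comp
          (strictMono_consecutive c h)), hx s c h hs.ne', ← Real.exp_add]
        simp

end Construction

section Limit

theorem IsPosTropPlucker.sub_sum {n k : ℕ} {P : Finset (Fin n) → ℝ} (hP : IsPosTropPlucker n k P)
    (lam : Fin n → ℝ) : IsPosTropPlucker n k fun I => P I - ∑ i ∈ I, lam i := by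
  intro S hS a b c d hab hbc hcd ha hb hc hd
  have hsum : ∀ x y, x < y → x ∉ S → y ∉ S →
      ∑ i ∈ S ∪ {x, y}, lam i = ∑ i ∈ S, lam i + (lam x + lam y) := by
    intro x y hxy hx hy
    rw [sum_union (by simp [hx, hy]), sum_pair hxy.ne]
  have hac := hab.trans hbc
  have hbd := hbc.trans hcd
  simp only [hsum a b hab ha hb, hsum a c hac ha hc, hsum a d (hac.trans hcd) ha hd,
    hsum b c hbc hb hc, hsum b d hbd hb hd, hsum c d hcd hc hd]
  rcases hP S hS a b c d hab hbc hcd ha hb hc hd with ⟨h1, h2⟩ | ⟨h1, h2⟩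
  · exact Or.inl ⟨by linarith, by linarith⟩
  · exact Or.inr ⟨by linarith, by linarith⟩

theorem pMinor_mul {k n : ℕ} (M : Matrix (Fin k) (Fin k) ℝ) (A : Matrix (Fin k) (Fin n) ℝ)
    {I : Finset (Fin n)} (hI : I.card = k) : pMinor (M * A) I = det M * pMinor A I := by
  have hg : univ.image (I.orderEmbOfFin hI) = I := I.image_orderEmbOfFin_univ hI
  rw [← hg, pMinor_image_of_strictMono _ (OrderEmbedding.strictMono _),
    pMinor_image_of_strictMono _ (OrderEmbedding.strictMono _), ← det_mul]
  rfl

/-- Limits of vectors of maximal minors are again vectors of maximal minors, up to a positive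
factor. -/
theorem exists_pMinor_eq_of_tendsto {k n : ℕ} (A : ℝ → Matrix (Fin k) (Fin n) ℝ) (w : ℝ → ℝ)
    (v : Finset (Fin n) → ℝ)
    (hv : ∀ I : Finset (Fin n), I.card = k →
      Tendsto (fun s => w s * pMinor (A s) I) atTop (𝓝 (v I)))
    {I₀ : Finset (Fin n)} (hI₀ : I₀.card = k) (hv₀ : 0 < v I₀) :
    ∃ N : Matrix (Fin k) (Fin n) ℝ, ∀ I : Finset (Fin n), I.card = k →
      pMinor N I = v I / v I₀ := by
  have hlim : ∀ f : Fin k → Fin n, ∃ l : ℝ,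
      Tendsto (fun s => w s * det ((A s).submatrix id f)) atTop (𝓝 l) := by
    intro f
    by_cases hf : Function.Injective f
    · have hc : (univ.image f).card = k := by rw [card_image_of_injective _ hf, card_fin]
      refine ⟨_, ((hv _ hc).const_mul (SignType.sign
        (det (vandermonde fun i => ((f i : ℕ) : ℝ))) : ℝ)).congr fun s => ?_⟩
      rw [det_submatrix_eq_sign_mul_pMinor _ hf]
      ring
    · obtain ⟨i, j, hij, hne⟩ := Function.not_injective_iff.1 hf
      refine ⟨0, tendsto_const_nhds.congr fun s => ?_⟩
      rw [det_zero_of_column_eq hne (fun l => by simp [hij]), mul_zero]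
  choose l hl using hlim
  set g := I₀.orderEmbOfFin hI₀
  have hg : univ.image g = I₀ := I₀.image_orderEmbOfFin_univ hI₀
  have hdet : ∀ s, det ((A s).submatrix id g) = pMinor (A s) I₀ := fun s => by
    rw [← pMinor_image_of_strictMono _ g.strictMono, hg]
  let M : ℝ → Matrix (Fin k) (Fin n) ℝ := fun s => ((A s).submatrix id g)⁻¹ * A s
  have hne : ∀ᶠ s in atTop, w s ≠ 0 ∧ pMinor (A s) I₀ ≠ 0 := by
    filter_upwards [(hv I₀ hI₀).eventually_ne hv₀.ne'] with s hs
    exact mul_ne_zero_iff.1 hs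
  have hentry : ∀ i j, ∀ᶠ s in atTop, M s i j =
      w s * det ((A s).submatrix id (Function.update g i j)) / (w s * pMinor (A s) I₀) := by
    intro i j
    filter_upwards [hne] with s hs
    have hup : (A s).submatrix id (Function.update g i j) =
        ((A s).submatrix id g).updateCol i fun r => A s r j := by
      ext r c
      by_cases h : c = i
      · subst h
        simp
      · simp [h]
    rw [hup, ← cramer_apply, mul_div_mul_left _ _ hs.1, ← hdet]
    have : M s i j = (((A s).submatrix id g)⁻¹ *ᵥ fun r => A s r j) i := rfl
    rw [this, Matrix.inv_def, smul_mulVec, ← cramer_eq_adjugate_mulVec, Pi.smul_apply,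
      Ring.inverse_eq_inv, smul_eq_mul, div_eq_inv_mul]
  let N : Matrix (Fin k) (Fin n) ℝ := of fun i j => l (Function.update g i j) / v I₀
  have hMN : ∀ i j, Tendsto (fun s => M s i j) atTop (𝓝 (N i j)) := fun i j =>
    ((hl _).div (hv I₀ hI₀) hv₀.ne').congr' ((hentry i j).mono fun s hs => hs.symm)
  have hMN' : Tendsto M atTop (𝓝 N) :=
    tendsto_pi_nhds.2 fun i => tendsto_pi_nhds.2 fun j => hMN i j
  refine ⟨N, fun I hI => ?_⟩
  have h1 : Tendsto (fun s => pMinor (M s) I) atTop (𝓝 (pMinor N I)) := by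
    simp only [pMinor, dif_pos hI]
    have hcont : Continuous fun X : Matrix (Fin k) (Fin n) ℝ =>
        det (of fun r c => X r ((I.orderIsoOfFin hI c : Fin n))) := by
      refine Continuous.matrix_det ?_
      exact continuous_pi fun r => continuous_pi fun c => continuous_apply_apply r _
    exact (hcont.tendsto N).comp hMN'
  refine tendsto_nhds_unique h1 (((hv I hI).div (hv I₀ hI₀) hv₀.ne').congr' ?_)
  filter_upwards [hne] with s hs
  rw [Pi.div_apply, mul_div_mul_left _ _ hs.1, pMinor_mul _ _ hI, det_nonsing_inv, hdet,
    Ring.inverse_eq_inv, div_eq_inv_mul]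

theorem IsPosTropPlucker.isPositroidFamily_faceOf {n k : ℕ} (hkn : k ≤ n)
    {P : Finset (Fin n) → ℝ} (hP : IsPosTropPlucker n k P) (lam : Fin n → ℝ) :
    IsPositroidFamily n k (FaceOf n k P lam) := by
  obtain ⟨r, A, hA⟩ := (hP.sub_sum lam).exists_hasExpOrder
  choose! c hc hlim using hA
  obtain ⟨I₀, hI₀, hmin⟩ := exists_min_image (powersetCard k (univ : Finset (Fin n)))
    (fun I => P I - ∑ i ∈ I, lam i) (powersetCard_nonempty.2 (by simpa using hkn))
  simp only [mem_powersetCard, subset_univ, true_and] at hI₀ hmin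
  set Q : Finset (Fin n) → ℝ := fun I => P I - ∑ i ∈ I, lam i with hQ
  have hface : ∀ I : Finset (Fin n), I.card = k → (I ∈ FaceOf n k P lam ↔ Q I = Q I₀) := by
    intro I hI
    refine ⟨fun h => ?_, fun h => ⟨hI, fun J hJ => ?_⟩⟩
    · have h1 := h.2 I₀ hI₀
      have h2 := hmin I hI
      simp only [hQ] at h2 ⊢
      linarith
    · have h2 := hmin J hJ
      simp only [hQ] at h h2
      linarith
  obtain ⟨N, hN⟩ := exists_pMinor_eq_of_tendsto A (fun s => Real.exp (s * (Q I₀ - r)))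
    (fun I => if Q I = Q I₀ then c I else 0) (fun I hI => by
      split_ifs with h
      · rw [← h]
        exact hlim I hI
      · have hlt : Q I₀ < Q I := (hmin I hI).lt_of_ne' h
        exact HasExpOrder.tendsto_of_lt ⟨c I, hc I hI, hlim I hI⟩ (by linarith)) hI₀
    (by simpa using hc I₀ hI₀)
  simp only [if_true] at hN
  have hc₀ := hc I₀ hI₀
  refine ⟨N, fun I hI => ?_, fun I => ⟨fun h => ⟨h.1, ?_⟩, fun h => ?_⟩⟩
  · rw [hN I hI]
    split_ifs
    · exact (div_pos (hc I hI) hc₀).le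
    · simp
  · rw [hN I h.1, if_pos ((hface I h.1).1 h)]
    exact (div_pos (hc I h.1) hc₀).ne'
  · rw [hface I h.1]
    by_contra hne
    exact h.2 (by rw [hN I h.1, if_neg hne, zero_div])

end Limit

end

/-- `P` is a positive tropical Plücker vector if and only if every face of the regular
subdivision `D_P` of the hypersimplex is the basis family of a positroid on `[n]`. -/
theorem stmt_7 (k n : ℕ) (hk : 0 < k) (hkn : k < n) (P : Finset (Fin n) → ℝ) :
    IsPosTropPlucker n k P ↔
      ∀ lam : Fin n → ℝ, IsPositroidFamily n k (FaceOf n k P lam) := by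
  exact ⟨fun hP => hP.isPositroidFamily_faceOf hkn.le, isPosTropPlucker_of_faceOf⟩
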